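/- arXiv:2103.16167 — 10 statements merged into one kernel-verified Lean document; each statement's English description precedes it below -/
import Mathlib

section
/- Let R : Fin n → Fin 4 → Fin m be a corner datum, let c : Fin m → ZMod 2 be a checkerboard coloring, and let u : Fin m → ℤ be a kernel solution for the alternating region choice matrix of the double counting rule. Define v : Fin m → ℤ by v(j) = u(j) if c(j) = 0 and v(j) = −u(j) if c(j) = 1. Then v is a kernel solution for the definite region choice matrix of the double counting rule. (Paper's Lemma: from a kernel solution for the alternating region choice matrix of the double counting rule and a fixed checkerboard coloring, the sign-twisted assignment (−1)^{c_R} u_R is a kernel solution for the definite region choice matrix of the double counting rule.) -/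
/-- From a kernel solution for the alternating region choice matrix of the double
counting rule and a checkerboard coloring, the sign-twisted assignment is a kernel
solution for the definite region choice matrix of the double counting rule. -/
theorem kernel_alt_to_def_double
    (n m : ℕ) (R : Fin n → Fin 4 → Fin m)
    (c : Fin m → ZMod 2)
    (hc : ∀ i : Fin n,
      c (R i 0) = c (R i 2) ∧ c (R i 1) = c (R i 3) ∧ c (R i 0) ≠ c (R i 1))
    (u : Fin m → ℤ)
    (hu : ∀ i : Fin n, u (R i 0) - u (R i 1) + u (R i 2) - u (R i 3) = 0)
    (v : Fin m → ℤ)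
    (hv : ∀ j : Fin m, v j = if c j = 0 then u j else - u j) :
    ∀ i : Fin n, v (R i 0) + v (R i 1) + v (R i 2) + v (R i 3) = 0 := by
  intro i
  obtain ⟨h02, h13, h01⟩ := hc i
  have hu := hu i
  have two_colors : ∀ a b : ZMod 2, a ≠ b → (a = 0 ∧ b ≠ 0) ∨ (a ≠ 0 ∧ b = 0) := by decide
  simp only [hv, ← h02, ← h13]
  rcases two_colors _ _ h01 with ⟨ha, hb⟩ | ⟨ha, hb⟩
  · rw [if_pos ha, if_neg hb, if_pos ha, if_neg hb]
    linarith
  · rw [if_neg ha, if_pos hb, if_neg ha, if_pos hb]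
    linarith
end

section
/- For all natural numbers n, m, all column vectors a, b : Fin n → ℤ and every matrix P : Matrix (Fin n) (Fin m) ℤ, the following holds. Let M be the n × (m+2) integer matrix whose ordered list of columns is (a, b, the columns of P), and let M' be the (n+1) × (m+3) integer matrix whose first row is (1, 2, 1, 0, …, 0) and whose remaining n rows are the rows of M each prepended by a 0 entry. Then rank M' = rank M + 1. (This is the block computation in the paper's Lemma that a Reidemeister move I preserves the rank of the ℤ-submodule of kernel solutions: if A_{d2}(D) = (a b P) then A_{d2}(D₊) = A_{d2}(D₋) = M'.) -/
open scoped Matrix in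
/-- Adjoining to a matrix over a principal ideal domain a first row with leading entry `1` and a
first column that vanishes below it raises the rank by one. -/
theorem Matrix.rank_of_cons_one_cons_zero {R : Type*} [CommRing R] [IsDomain R]
    [IsPrincipalIdealRing R] {n k : ℕ} (v : Fin k → R) (M : Fin n → Fin k → R) :
    (Matrix.of (Fin.cons (Fin.cons 1 v : Fin (k + 1) → R)
        (fun i : Fin n => (Fin.cons 0 (M i) : Fin (k + 1) → R)) :
          Fin (n + 1) → Fin (k + 1) → R)).rank = (Matrix.of M).rank + 1 := by
  set A := Matrix.of (Fin.cons (Fin.cons 1 v : Fin (k + 1) → R)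
        (fun i : Fin n => (Fin.cons 0 (M i) : Fin (k + 1) → R)) :
          Fin (n + 1) → Fin (k + 1) → R)
  have mulVec_eq (w : Fin (k + 1) → R) :
      A *ᵥ w = Fin.cons (w 0 + v ⬝ᵥ Fin.tail w) (Matrix.of M *ᵥ Fin.tail w) := by
    ext i
    refine Fin.cases ?_ (fun i => ?_) i <;>
      simp [A, Matrix.mulVec, dotProduct, Fin.sum_univ_succ, Fin.tail]
  let p := LinearMap.range (Matrix.of M).mulVecLin
  let L : R × p →ₗ[R] Fin (n + 1) → R :=
    (Fin.consLinearEquiv R fun _ : Fin (n + 1) => R).toLinearMap ∘ₗ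
      LinearMap.prodMap LinearMap.id p.subtype
  have L_injective : Function.Injective L :=
    (Fin.consLinearEquiv R fun _ : Fin (n + 1) => R).injective.comp
      (Function.injective_id.prodMap p.injective_subtype)
  have range_eq : LinearMap.range A.mulVecLin = LinearMap.range L := by
    apply le_antisymm
    · rintro _ ⟨w, rfl⟩
      exact ⟨(w 0 + v ⬝ᵥ Fin.tail w, ⟨Matrix.of M *ᵥ Fin.tail w, Fin.tail w, rfl⟩),
        (mulVec_eq w).symm⟩
    · rintro _ ⟨⟨x, _, y, rfl⟩, rfl⟩
      refine ⟨Fin.cons (x - v ⬝ᵥ y) y, ?_⟩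
      rw [Matrix.mulVecLin_apply, mulVec_eq, Fin.tail_cons, Fin.cons_zero, sub_add_cancel]
      rfl
  rw [Matrix.rank, range_eq, LinearMap.finrank_range_of_inj L_injective, Module.finrank_prod,
    Module.finrank_self, add_comm]
  rfl

/-- Reidemeister move I rank computation for the definite region choice matrix of
the double counting rule: if `M = (a b P)` then the matrix `M'` with first row
`(1, 2, 1, 0, …, 0)` and remaining rows `(0, a_i, b_i, P_i)` satisfies
`rank M' = rank M + 1`. -/
theorem reidemeister_I_rank_def_double
    (n m : ℕ) (a b : Fin n → ℤ) (P : Matrix (Fin n) (Fin m) ℤ) :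
    (Matrix.of (Fin.cons
        (Fin.cons 1 (Fin.cons 2 (Fin.cons 1 (fun _ : Fin m => (0 : ℤ)))))
        (fun i : Fin n =>
          Fin.cons 0 (Fin.cons (a i) (Fin.cons (b i) (P i)))))).rank
      = (Matrix.of (fun i : Fin n =>
          Fin.cons (a i) (Fin.cons (b i) (P i)))).rank + 1 := by
  exact Matrix.rank_of_cons_one_cons_zero _ _
end

section
/- For all natural numbers n, m, all column vectors a, b', b'', c : Fin n → ℤ and every matrix P : Matrix (Fin n) (Fin m) ℤ, the following holds. Let M be the n × (m+3) integer matrix whose ordered list of columns is (a, b' + b'', c, the columns of P), and let M' be the (n+2) × (m+5) integer matrix whose first row is (1, 1, 1, 0, 1, 0, …, 0), whose second row is (1, 1, 0, 1, 1, 0, …, 0), and whose remaining n rows are (0, a_i, b'_i, b''_i, c_i, P_i) (the i-th rows of the columns a, b', b'', c, P prepended by a 0 entry). Then rank M' = rank M + 2. (This is the block computation in the paper's Lemma that a Reidemeister move II, which keeps the number of connected components of the diagram and in which the three regions appearing around the move are distinct, preserves the rank of the ℤ-submodule of kernel solutions for the definite region choice matrix of the double counting rule: A_{d2}(D) = (a,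 b'+b'', c, P) and A_{d2}(D') = M'.) -/
namespace Matrix

theorem rank_add_finrank_ker_mulVecLin {ι : Type*} {k : ℕ} (A : Matrix ι (Fin k) ℤ) :
    A.rank + Module.finrank ℤ (LinearMap.ker A.mulVecLin) = k := by
  rw [Matrix.rank, ← A.mulVecLin.quotKerEquivRange.finrank_eq,
    Submodule.finrank_quotient_add_finrank, Module.finrank_fin_fun]

end Matrix

/-- Duplicates the coordinate of index one and prepends the negated sum of the first three
coordinates. -/
def reidemeisterIILift (m : ℕ) : (Fin (m + 3) → ℤ) →ₗ[ℤ] (Fin (m + 5) → ℤ) where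
  toFun y := Fin.cons (-(y 0 + y (Fin.succ 0) + y (Fin.succ 0).succ)) (Fin.cons (y 0)
    (Fin.cons (y (Fin.succ 0)) (Fin.cons (y (Fin.succ 0))
      (fun j : Fin (m + 1) => y j.succ.succ))))
  map_add' x y := by
    ext i
    refine Fin.cases ?_ (Fin.cases ?_ (Fin.cases ?_ (Fin.cases ?_ fun i => ?_))) i <;>
      simp only [Fin.cons_zero, Fin.cons_succ, Pi.add_apply]
    ring
  map_smul' r y := by
    ext i
    refine Fin.cases ?_ (Fin.cases ?_ (Fin.cases ?_ (Fin.cases ?_ fun i => ?_))) i <;>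
      simp only [Fin.cons_zero, Fin.cons_succ, Pi.smul_apply, smul_eq_mul, RingHom.id_apply]
    ring

theorem reidemeisterIILift_apply (m : ℕ) (y : Fin (m + 3) → ℤ) :
    reidemeisterIILift m y = Fin.cons (-(y 0 + y (Fin.succ 0) + y (Fin.succ 0).succ))
      (Fin.cons (y 0) (Fin.cons (y (Fin.succ 0)) (Fin.cons (y (Fin.succ 0))
      (fun j : Fin (m + 1) => y j.succ.succ)))) := rfl

theorem reidemeisterIILift_injective (m : ℕ) : Function.Injective (reidemeisterIILift m) := by
  intro x y h
  simp only [reidemeisterIILift_apply, Fin.cons_inj] at h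
  obtain ⟨-, h0, h1, -, h2⟩ := h
  ext i
  exact Fin.cases h0 (Fin.cases h1 fun j => congrFun h2 j) i

/-- Reidemeister move II rank computation (definite, double counting rule; the
three regions around the move are distinct and the number of connected components
is preserved): if `M = (a, b'+b'', c, P)` then the matrix `M'` with first row
`(1,1,1,0,1,0,…,0)`, second row `(1,1,0,1,1,0,…,0)` and remaining rows
`(0, a_i, b'_i, b''_i, c_i, P_i)` satisfies `rank M' = rank M + 2`. -/
theorem reidemeister_II_rank_def_double
    (n m : ℕ) (a b' b'' c : Fin n → ℤ) (P : Matrix (Fin n) (Fin m) ℤ) :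
    (Matrix.of (Fin.cons
        (Fin.cons 1 (Fin.cons 1 (Fin.cons 1 (Fin.cons 0 (Fin.cons 1
          (fun _ : Fin m => (0 : ℤ)))))))
      (Fin.cons
        (Fin.cons 1 (Fin.cons 1 (Fin.cons 0 (Fin.cons 1 (Fin.cons 1
          (fun _ : Fin m => (0 : ℤ)))))))
        (fun i : Fin n =>
          Fin.cons 0 (Fin.cons (a i) (Fin.cons (b' i) (Fin.cons (b'' i)
            (Fin.cons (c i) (P i))))))))).rank
      = (Matrix.of (fun i : Fin n =>
          Fin.cons (a i) (Fin.cons (b' i + b'' i) (Fin.cons (c i) (P i))))).rank + 2 := by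
  set A' := Matrix.of _ with hA'
  set A := Matrix.of (fun i : Fin n => _) with hA
  have hker : LinearMap.ker A'.mulVecLin =
      (LinearMap.ker A.mulVecLin).map (reidemeisterIILift m) := by
    ext x
    simp only [Submodule.mem_map, LinearMap.mem_ker, Matrix.mulVecLin_apply, funext_iff,
      Pi.zero_apply, Matrix.mulVec, dotProduct, Fin.forall_fin_succ, hA', hA, Matrix.of_apply,
      Fin.sum_univ_succ, Fin.cons_zero, Fin.cons_succ, reidemeisterIILift_apply]
    simp only [zero_mul, one_mul, Finset.sum_const_zero, zero_add, add_zero]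
    constructor
    · rintro ⟨h0, h1, h⟩
      have h2 : x (Fin.succ 0).succ = x (Fin.succ 0).succ.succ := by linarith
      refine ⟨Fin.cons (x (Fin.succ 0)) (Fin.cons (x (Fin.succ 0).succ)
        (fun j => x j.succ.succ.succ.succ)), ?_⟩
      simp only [Fin.cons_zero, Fin.cons_succ, true_and, and_true, implies_true]
      refine ⟨fun i => ?_, by linarith, h2⟩
      have h3 := h i
      rw [← h2] at h3
      linarith
    · rintro ⟨y, h, h0, h1, h2, h3, h4, h5⟩
      simp only [← h0, ← h1, ← h2, ← h3, ← h4, ← h5]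
      refine ⟨by ring, by ring, fun i => ?_⟩
      linarith [h i]
  have hfin : Module.finrank ℤ (LinearMap.ker A'.mulVecLin) =
      Module.finrank ℤ (LinearMap.ker A.mulVecLin) := by
    rw [hker]
    exact (Submodule.equivMapOfInjective _ (reidemeisterIILift_injective m) _).finrank_eq.symm
  have h' := A'.rank_add_finrank_ker_mulVecLin
  have h := A.rank_add_finrank_ker_mulVecLin
  omega
end

section
/- For all natural numbers n, m, all column vectors a, b', b'', c : Fin n → ℤ and every matrix P : Matrix (Fin n) (Fin m) ℤ, the following holds. Let M be the n × (m+3) integer matrix whose ordered list of columns is (a, b' + b'', c, the columns of P), and let M' be the (n+2) × (m+5) integer matrix whose first row is (1, −1, 1, 0, −1, 0, …, 0), whose second row is (−1, 1, 0, −1, 1, 0, …, 0), and whose remaining n rows are (0, a_i, b'_i, b''_i, c_i, P_i). Then rank M' = rank M + 2. (This is the block computation in the paper's Lemma that a Reidemeister move II, which keeps the number of connected components of the diagram and in which the three regions appearing around the move are distinct, preserves the rank of the ℤ-submodule of kernel solutions for the alternating region choice matrix of the double counting rule: A_{a2}(D) = (a, b'+b'', c, P) and A_{a2}(D') = M'.)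 -/
/-- Matrices whose kernels are isomorphic have ranks differing by the difference of their widths. -/
theorem Matrix.rank_eq_rank_add_of_ker_equiv {p q r s k : ℕ} {A : Matrix (Fin p) (Fin q) ℤ}
    {B : Matrix (Fin r) (Fin s) ℤ} (hq : q = s + k)
    (e : LinearMap.ker A.mulVecLin ≃ₗ[ℤ] LinearMap.ker B.mulVecLin) :
    A.rank = B.rank + k := by
  have hA := (LinearMap.ker A.mulVecLin).finrank_quotient_add_finrank
  have hB := (LinearMap.ker B.mulVecLin).finrank_quotient_add_finrank
  rw [A.mulVecLin.quotKerEquivRange.finrank_eq, Module.finrank_fin_fun] at hA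
  rw [B.mulVecLin.quotKerEquivRange.finrank_eq, Module.finrank_fin_fun] at hB
  rw [e.finrank_eq] at hA
  unfold Matrix.rank
  omega

/-- Reidemeister move II rank computation (alternating, double counting rule; the
three regions around the move are distinct and the number of connected components
is preserved): if `M = (a, b'+b'', c, P)` then the matrix `M'` with first row
`(1,-1,1,0,-1,0,…,0)`, second row `(-1,1,0,-1,1,0,…,0)` and remaining rows
`(0, a_i, b'_i, b''_i, c_i, P_i)` satisfies `rank M' = rank M + 2`. -/
theorem reidemeister_II_rank_alt_double
    (n m : ℕ) (a b' b'' c : Fin n → ℤ) (P : Matrix (Fin n) (Fin m) ℤ) :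
    (Matrix.of (Fin.cons
        (Fin.cons 1 (Fin.cons (-1) (Fin.cons 1 (Fin.cons 0 (Fin.cons (-1)
          (fun _ : Fin m => (0 : ℤ)))))))
      (Fin.cons
        (Fin.cons (-1) (Fin.cons 1 (Fin.cons 0 (Fin.cons (-1) (Fin.cons 1
          (fun _ : Fin m => (0 : ℤ)))))))
        (fun i : Fin n =>
          Fin.cons 0 (Fin.cons (a i) (Fin.cons (b' i) (Fin.cons (b'' i)
            (Fin.cons (c i) (P i))))))))).rank
      = (Matrix.of (fun i : Fin n =>
          Fin.cons (a i) (Fin.cons (b' i + b'' i) (Fin.cons (c i) (P i))))).rank + 2 := by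
  refine Matrix.rank_eq_rank_add_of_ker_equiv rfl
    { toFun := fun x => ⟨Fin.cons (x.1 (Fin.succ 0)) (Fin.cons (x.1 (Fin.succ (Fin.succ 0)))
        (Fin.cons (x.1 (Fin.succ (Fin.succ (Fin.succ (Fin.succ 0)))))
          fun j => x.1 j.succ.succ.succ.succ.succ)), ?_⟩
      map_add' := ?_
      map_smul' := ?_
      invFun := fun y => ⟨Fin.cons (y.1 0 - y.1 (Fin.succ 0) + y.1 (Fin.succ (Fin.succ 0)))
        (Fin.cons (y.1 0) (Fin.cons (y.1 (Fin.succ 0)) (Fin.cons (y.1 (Fin.succ 0))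
          (Fin.cons (y.1 (Fin.succ (Fin.succ 0))) fun j => y.1 j.succ.succ.succ)))), ?_⟩
      left_inv := ?_
      right_inv := ?_ }
  · obtain ⟨x, hx⟩ := x
    have h := congrFun (LinearMap.mem_ker.mp hx)
    have h₀ := h 0
    have h₁ := h (Fin.succ 0)
    rw [LinearMap.mem_ker]
    ext i
    have h₂ := h i.succ.succ
    simp only [Matrix.mulVecLin_apply, Matrix.mulVec, dotProduct, Matrix.of_apply,
      Fin.sum_univ_succ, Fin.cons_zero, Fin.cons_succ, Pi.zero_apply, zero_mul,
      Finset.sum_const_zero] at h₀ h₁ h₂ ⊢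
    have h₃ : x (Fin.succ (Fin.succ (Fin.succ 0))) = x (Fin.succ (Fin.succ 0)) := by
      linarith
    rw [h₃] at h₂
    linarith
  · intro x y
    ext j
    refine Fin.cases ?_ (Fin.cases ?_ (Fin.cases ?_ fun j => ?_)) j <;> rfl
  · intro t x
    ext j
    refine Fin.cases ?_ (Fin.cases ?_ (Fin.cases ?_ fun j => ?_)) j <;> rfl
  · obtain ⟨y, hy⟩ := y
    have h := congrFun (LinearMap.mem_ker.mp hy)
    rw [LinearMap.mem_ker]
    ext i
    refine Fin.cases ?_ (Fin.cases ?_ fun i => ?_) i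
    rotate_left 2
    · have h₀ := h i
      simp only [Matrix.mulVecLin_apply, Matrix.mulVec, dotProduct, Matrix.of_apply,
        Fin.sum_univ_succ, Fin.cons_zero, Fin.cons_succ, Pi.zero_apply] at h₀ ⊢
      linarith
    all_goals
      simp only [Matrix.mulVecLin_apply, Matrix.mulVec, dotProduct, Matrix.of_apply,
        Fin.sum_univ_succ, Fin.cons_zero, Fin.cons_succ, Pi.zero_apply, zero_mul,
        Finset.sum_const_zero]
      ring
  · rintro ⟨x, hx⟩
    have h := congrFun (LinearMap.mem_ker.mp hx)
    have h₀ := h 0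
    have h₁ := h (Fin.succ 0)
    simp only [Matrix.mulVecLin_apply, Matrix.mulVec, dotProduct, Matrix.of_apply,
      Fin.sum_univ_succ, Fin.cons_zero, Fin.cons_succ, Pi.zero_apply, zero_mul,
      Finset.sum_const_zero] at h₀ h₁
    ext j
    refine Fin.cases ?_ (Fin.cases ?_ (Fin.cases ?_ (Fin.cases ?_ (Fin.cases ?_ fun j => ?_)))) j
    all_goals
      simp only [Fin.cons_zero, Fin.cons_succ]
    all_goals linarith
  · rintro ⟨y, hy⟩
    ext j
    refine Fin.cases ?_ (Fin.cases ?_ (Fin.cases ?_ fun j => ?_)) j <;> rfl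
end

section
/- For all natural numbers n, m, all column vectors a, b', b'' : Fin n → ℤ and every matrix P : Matrix (Fin n) (Fin m) ℤ, the following holds. Let M be the n × (m+2) integer matrix whose ordered list of columns is (a, b' + b'', the columns of P), and let M' be the (n+2) × (m+4) integer matrix whose first row is (1, 2, 1, 0, 0, …, 0), whose second row is (1, 2, 0, 1, 0, …, 0), and whose remaining n rows are (0, a_i, b'_i, b''_i, P_i). Then rank M' = rank M + 2. (This is the block computation in the paper's Lemma for a Reidemeister move II in which the top and bottom regions around the move coincide: A_{d2}(D) = (a, b'+b'', P) and A_{d2}(D') = M', and the move preserves the rank of the ℤ-submodule of kernel solutions of the definite region choice matrix of the double counting rule.) -/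
/-- Over `ℤ`, two matrices whose kernels correspond under an injective linear map have the same
nullity, so their ranks differ by the difference in the number of columns. -/
theorem Matrix.rank_eq_rank_add_of_map_ker {m₁ m₂ : Type*} {c d : ℕ}
    [Fintype m₁] [Fintype m₂] (A : Matrix m₁ (Fin (c + d)) ℤ) (B : Matrix m₂ (Fin c) ℤ)
    (g : (Fin c → ℤ) →ₗ[ℤ] (Fin (c + d) → ℤ)) (hg : Function.Injective g)
    (h : (LinearMap.ker B.mulVecLin).map g = LinearMap.ker A.mulVecLin) :
    A.rank = B.rank + d := by
  have hA := Submodule.finrank_quotient_add_finrank (LinearMap.ker A.mulVecLin)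
  have hB := Submodule.finrank_quotient_add_finrank (LinearMap.ker B.mulVecLin)
  rw [A.mulVecLin.quotKerEquivRange.finrank_eq] at hA
  rw [B.mulVecLin.quotKerEquivRange.finrank_eq] at hB
  rw [← h, (Submodule.equivMapOfInjective g hg _).symm.finrank_eq] at hA
  simp only [Module.finrank_fin_fun] at hA hB
  unfold Matrix.rank
  omega

/-- The linear map `(x, y, z) ↦ (-y - 2 * x, x, y, y, z)`. -/
def reidemeisterKerMap (m : ℕ) : (Fin (m + 1 + 1) → ℤ) →ₗ[ℤ] (Fin (m + 1 + 1 + 2) → ℤ) where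
  toFun v := Fin.cons (-v (Fin.succ 0) - 2 * v 0)
    (Fin.cons (v 0) (Fin.cons (v (Fin.succ 0)) (Fin.tail v)))
  map_add' v w := by
    ext i
    refine Fin.cases ?_ (Fin.cases ?_ (Fin.cases ?_ fun i => ?_)) i <;>
      simp only [Fin.tail, Pi.add_apply, Fin.cons_zero, Fin.cons_succ]
    ring
  map_smul' r v := by
    ext i
    refine Fin.cases ?_ (Fin.cases ?_ (Fin.cases ?_ fun i => ?_)) i <;>
      simp only [Fin.tail, Pi.smul_apply, Fin.cons_zero, Fin.cons_succ, smul_eq_mul,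
        RingHom.id_apply]
    ring

theorem reidemeisterKerMap_apply {m : ℕ} (v : Fin (m + 1 + 1) → ℤ) :
    reidemeisterKerMap m v =
      Fin.cons (-v (Fin.succ 0) - 2 * v 0)
        (Fin.cons (v 0) (Fin.cons (v (Fin.succ 0)) (Fin.tail v))) := rfl

theorem reidemeisterKerMap_injective (m : ℕ) : Function.Injective (reidemeisterKerMap m) := by
  intro v w h
  simp only [reidemeisterKerMap_apply, Fin.cons_inj] at h
  rw [← Fin.cons_self_tail v, ← Fin.cons_self_tail w, h.2.1, h.2.2.2]

/-- Reidemeister move II rank computation (definite, double counting rule; the top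
and bottom regions at the site of the move coincide): if `M = (a, b'+b'', P)` then
the matrix `M'` with first row `(1,2,1,0,0,…,0)`, second row `(1,2,0,1,0,…,0)` and
remaining rows `(0, a_i, b'_i, b''_i, P_i)` satisfies `rank M' = rank M + 2`. -/
theorem reidemeister_II_rank_def_double_coinciding
    (n m : ℕ) (a b' b'' : Fin n → ℤ) (P : Matrix (Fin n) (Fin m) ℤ) :
    (Matrix.of (Fin.cons
        (Fin.cons 1 (Fin.cons 2 (Fin.cons 1 (Fin.cons 0
          (fun _ : Fin m => (0 : ℤ))))))
      (Fin.cons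
        (Fin.cons 1 (Fin.cons 2 (Fin.cons 0 (Fin.cons 1
          (fun _ : Fin m => (0 : ℤ))))))
        (fun i : Fin n =>
          Fin.cons 0 (Fin.cons (a i) (Fin.cons (b' i) (Fin.cons (b'' i)
            (P i)))))))).rank
      = (Matrix.of (fun i : Fin n =>
          Fin.cons (a i) (Fin.cons (b' i + b'' i) (P i)))).rank + 2 := by
  refine Matrix.rank_eq_rank_add_of_map_ker _ _ (reidemeisterKerMap m)
    (reidemeisterKerMap_injective m) ?_
  ext x
  simp only [Submodule.mem_map, LinearMap.mem_ker, Matrix.mulVecLin_apply, funext_iff,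
    Matrix.mulVec, dotProduct, Fin.forall_fin_succ (n := n + 1), Fin.forall_fin_succ (n := n),
    Matrix.of_apply, Fin.cons_zero, Fin.cons_succ, Pi.zero_apply, Fin.sum_univ_succ,
    reidemeisterKerMap_apply, zero_mul, one_mul, Finset.sum_const_zero, zero_add, add_zero]
  constructor
  · rintro ⟨v, hv, hx⟩
    obtain rfl := funext hx
    simp only [Fin.cons_zero, Fin.cons_succ, Fin.tail]
    refine ⟨by ring, by ring, fun i => ?_⟩
    rw [← hv i]
    ring
  · rintro ⟨h₁, h₂, h⟩
    have h₃ : x (Fin.succ 0).succ = x (Fin.succ 0).succ.succ := by linarith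
    refine ⟨Fin.cons (x (Fin.succ 0)) fun i => x i.succ.succ.succ, fun i => ?_, ?_⟩
    · simp only [Fin.cons_zero, Fin.cons_succ]
      rw [← h i, h₃]
      ring
    · refine Fin.cases ?_ (Fin.cases ?_ (Fin.cases ?_ fun i => ?_)) <;>
        simp only [Fin.cons_zero, Fin.cons_succ, Fin.tail]
      · linarith
      · exact h₃.symm
end

section
/- For all natural numbers n, m, all column vectors a, b, c : Fin n → ℤ and every matrix P : Matrix (Fin n) (Fin m) ℤ, the following holds. Let M be the n × (m+3) integer matrix whose ordered list of columns is (a, b, c, the columns of P), and let M' be the (n+2) × (m+4) integer matrix whose first two rows are both (1, 1, 1, 1, 0, …, 0) and whose remaining n rows are (0, a_i, b_i, c_i, P_i). Then rank M' = rank M + 1. (This is the block computation in the paper's Lemma for a Reidemeister move II that changes the number of connected components of the diagram: A_{d2}(D) = (a, b, c, P), A_{d2}(D') = M', and the move preserves the rank of the ℤ-submodule of kernel solutions of the definite region choice matrix of the double counting rule, since M' has one more column than M and its rank is rank M + 1.) -/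
/-- If the kernel of `B` is the graph of a linear form `r` over the kernel of `A`, with the value
of `r` in the first coordinate, then `B` has rank one more than `A`. -/
theorem Matrix.rank_eq_rank_add_one_of_ker_eq_graph {R μ ν : Type*} [CommRing R] [IsDomain R]
    {k : ℕ} (A : Matrix μ (Fin k) R) (B : Matrix ν (Fin (k + 1)) R) (r : (Fin k → R) →ₗ[R] R)
    (h : ∀ t v, B.mulVec (Fin.cons t v) = 0 ↔ t = r v ∧ A.mulVec v = 0) :
    B.rank = A.rank + 1 := by
  let f : (Fin k → R) →ₗ[R] (Fin (k + 1) → R) := LinearMap.pi (Fin.cons r LinearMap.proj)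
  have hf : ∀ v, f v = Fin.cons (r v) v := by
    intro v
    ext i
    refine Fin.cases ?_ (fun j => ?_) i <;> simp [f]
  have hinj : Function.Injective f := by
    intro v w hvw
    rw [hf, hf] at hvw
    exact (Fin.cons_injective2 hvw).2
  have hker : A.mulVecLin.ker.map f = B.mulVecLin.ker := by
    ext x
    simp only [Submodule.mem_map, LinearMap.mem_ker, Matrix.mulVecLin_apply, hf]
    constructor
    · rintro ⟨v, hv, rfl⟩
      exact (h _ _).2 ⟨rfl, hv⟩
    · intro hx
      rw [← Fin.cons_self_tail x] at hx ⊢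
      obtain ⟨ht, hv⟩ := (h _ _).1 hx
      exact ⟨_, hv, by rw [← ht]⟩
  have hfin : Module.finrank R B.mulVecLin.ker = Module.finrank R A.mulVecLin.ker := by
    rw [← hker]
    exact (Submodule.equivMapOfInjective f hinj _).finrank_eq.symm
  have hA := Submodule.finrank_quotient_add_finrank A.mulVecLin.ker
  have hB := Submodule.finrank_quotient_add_finrank B.mulVecLin.ker
  rw [A.mulVecLin.quotKerEquivRange.finrank_eq, Module.finrank_fin_fun] at hA
  rw [B.mulVecLin.quotKerEquivRange.finrank_eq, Module.finrank_fin_fun] at hB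
  unfold Matrix.rank
  omega


/-- Reidemeister move II rank computation (definite, double counting rule; the
move changes the number of connected components of the diagram): if
`M = (a, b, c, P)` then the matrix `M'` whose first two rows are both
`(1,1,1,1,0,…,0)` and whose remaining rows are `(0, a_i, b_i, c_i, P_i)` satisfies
`rank M' = rank M + 1`. -/
theorem reidemeister_II_rank_def_double_split
    (n m : ℕ) (a b c : Fin n → ℤ) (P : Matrix (Fin n) (Fin m) ℤ) :
    (Matrix.of (Fin.cons
        (Fin.cons 1 (Fin.cons 1 (Fin.cons 1 (Fin.cons 1
          (fun _ : Fin m => (0 : ℤ))))))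
      (Fin.cons
        (Fin.cons 1 (Fin.cons 1 (Fin.cons 1 (Fin.cons 1
          (fun _ : Fin m => (0 : ℤ))))))
        (fun i : Fin n =>
          Fin.cons 0 (Fin.cons (a i) (Fin.cons (b i) (Fin.cons (c i)
            (P i)))))))).rank
      = (Matrix.of (fun i : Fin n =>
          Fin.cons (a i) (Fin.cons (b i) (Fin.cons (c i) (P i))))).rank + 1 := by
  refine Matrix.rank_eq_rank_add_one_of_ker_eq_graph _ _
    (-(LinearMap.proj (R := ℤ) (φ := fun _ : Fin (m + 3) => ℤ) 0 + LinearMap.proj 1 + LinearMap.proj 2)) fun t v => ?_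
  have h1 : v 1 = v (Fin.succ 0) := rfl
  have h2 : v 2 = v (Fin.succ (Fin.succ 0)) := rfl
  simp only [funext_iff, Fin.forall_fin_succ, Matrix.mulVec, dotProduct, Fin.sum_univ_succ,
    Matrix.of_apply, Fin.cons_zero, Fin.cons_succ, Pi.zero_apply, zero_mul, one_mul, zero_add,
    Finset.sum_const_zero, add_zero, LinearMap.neg_apply, LinearMap.add_apply,
    LinearMap.proj_apply, h1, h2]
  constructor
  · rintro ⟨ht, -, hv⟩
    exact ⟨by linarith, hv⟩
  · rintro ⟨rfl, hv⟩
    exact ⟨by ring, by ring, hv⟩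
end

section
/- For all natural numbers n, m, all column vectors a, b, c, d, e, f : Fin n → ℤ and every matrix P : Matrix (Fin n) (Fin m) ℤ, the following holds. Let M∇ be the (n+3) × (m+7) integer matrix whose first three rows are (1,1,1,0,0,0,1,0,…,0), (1,0,1,1,1,0,0,0,…,0), (1,0,0,0,1,1,1,0,…,0) and whose remaining n rows are (0, a_i, b_i, c_i, d_i, e_i, f_i, P_i), and let MΔ be the (n+3) × (m+7) integer matrix whose first three rows are (1,0,0,1,1,1,0,0,…,0), (1,1,0,0,0,1,1,0,…,0), (1,1,1,1,0,0,0,0,…,0) and whose remaining n rows are (0, a_i, b_i, c_i, d_i, e_i, f_i, P_i). Then rank M∇ = rank MΔ. (This is the block computation in the paper's Lemma that a Reidemeister move III, in which the seven regions appearing around the move are distinct, preserves the rank of the ℤ-submodule of kernel solutions of the definite region choice matrix of the double counting rule: A_{d2}(D∇) = M∇ and A_{d2}(DΔ) = MΔ; in the proof MΔ is obtained from M∇ by multiplying the top three rows and the first column by −1 and then adding the first column to each of the next six columns.) -/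
/-- Two matrices whose linear maps agree up to automorphisms of the source and the target
have the same rank. -/
theorem Matrix.rank_eq_of_mulVec_eq {R p q : Type*} [CommRing R] [Fintype q]
    {M N : Matrix p q R} (D : (p → R) ≃ₗ[R] (p → R)) (C : (q → R) ≃ₗ[R] (q → R))
    (h : ∀ x, D (M.mulVec (C x)) = N.mulVec x) : M.rank = N.rank := by
  have hN : N.mulVecLin = D.toLinearMap ∘ₗ M.mulVecLin ∘ₗ C.toLinearMap :=
    LinearMap.ext fun x => (h x).symm
  rw [Matrix.rank, Matrix.rank, hN, LinearMap.range_comp, LinearEquiv.range_comp]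
  exact (LinearEquiv.finrank_map_eq D _).symm

/-- Negation of the first three coordinates of a vector. -/
def negFirstThree (n : ℕ) : (Fin (n + 3) → ℤ) ≃ₗ[ℤ] (Fin (n + 3) → ℤ) :=
  LinearEquiv.ofInvolutive
    { toFun := fun y => Fin.cons (-y 0) (Fin.cons (-y 1) (Fin.cons (-y 2)
        fun i : Fin n => y i.succ.succ.succ))
      map_add' := fun x y => by
        ext i
        refine Fin.cases ?_ (Fin.cases ?_ (Fin.cases ?_ fun i => ?_)) i
        · exact neg_add (x 0) (y 0)
        · exact neg_add (x 1) (y 1)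
        · exact neg_add (x 2) (y 2)
        · rfl
      map_smul' := fun r y => by
        ext i
        refine Fin.cases ?_ (Fin.cases ?_ (Fin.cases ?_ fun i => ?_)) i
        · exact (mul_neg r (y 0)).symm
        · exact (mul_neg r (y 1)).symm
        · exact (mul_neg r (y 2)).symm
        · rfl }
    fun y => by
      ext i
      refine Fin.cases ?_ (Fin.cases ?_ (Fin.cases ?_ fun i => ?_)) i
      · exact neg_neg (y 0)
      · exact neg_neg (y 1)
      · exact neg_neg (y 2)
      · rfl

/-- The change of variables that replaces the first coordinate of a vector by minus the sum of
its first seven coordinates. -/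
def negSumFirstSeven (m : ℕ) : (Fin (m + 7) → ℤ) ≃ₗ[ℤ] (Fin (m + 7) → ℤ) :=
  LinearEquiv.ofInvolutive
    { toFun := fun x => Fin.cons (-(x 0 + x 1 + x 2 + x 3 + x 4 + x 5 + x 6))
        fun j : Fin (m + 6) => x j.succ
      map_add' := fun x y => by
        ext j
        refine Fin.cases ?_ (fun j => ?_) j
        · simp only [Fin.cons_zero, Pi.add_apply]
          ring
        · simp
      map_smul' := fun r x => by
        ext j
        refine Fin.cases ?_ (fun j => ?_) j
        · simp only [Fin.cons_zero, Pi.smul_apply, smul_eq_mul, RingHom.id_apply]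
          ring
        · simp }
    fun x => by
      ext j
      refine Fin.cases ?_ (fun j => ?_) j
      · change -(-(x 0 + x 1 + x 2 + x 3 + x 4 + x 5 + x 6) + x 1 + x 2 + x 3 + x 4 + x 5 + x 6)
          = x 0
        ring
      · rfl

/-- Reidemeister move III rank computation (definite, double counting rule; the
seven regions around the move are distinct): the matrices `M∇` and `MΔ` whose
first three rows are `(1,1,1,0,0,0,1,0,…,0)`, `(1,0,1,1,1,0,0,0,…,0)`,
`(1,0,0,0,1,1,1,0,…,0)` and `(1,0,0,1,1,1,0,0,…,0)`, `(1,1,0,0,0,1,1,0,…,0)`,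
`(1,1,1,1,0,0,0,0,…,0)` respectively, with common remaining rows
`(0, a_i, b_i, c_i, d_i, e_i, f_i, P_i)`, have the same rank. -/
theorem reidemeister_III_rank_def_double
    (n m : ℕ) (a b c d e f : Fin n → ℤ) (P : Matrix (Fin n) (Fin m) ℤ) :
    (Matrix.of (Fin.cons
        (Fin.cons 1 (Fin.cons 1 (Fin.cons 1 (Fin.cons 0 (Fin.cons 0 (Fin.cons 0
          (Fin.cons 1 (fun _ : Fin m => (0 : ℤ)))))))))
      (Fin.cons
        (Fin.cons 1 (Fin.cons 0 (Fin.cons 1 (Fin.cons 1 (Fin.cons 1 (Fin.cons 0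
          (Fin.cons 0 (fun _ : Fin m => (0 : ℤ)))))))))
      (Fin.cons
        (Fin.cons 1 (Fin.cons 0 (Fin.cons 0 (Fin.cons 0 (Fin.cons 1 (Fin.cons 1
          (Fin.cons 1 (fun _ : Fin m => (0 : ℤ)))))))))
        (fun i : Fin n =>
          Fin.cons 0 (Fin.cons (a i) (Fin.cons (b i) (Fin.cons (c i)
            (Fin.cons (d i) (Fin.cons (e i) (Fin.cons (f i) (P i)))))))))))).rank
    = (Matrix.of (Fin.cons
        (Fin.cons 1 (Fin.cons 0 (Fin.cons 0 (Fin.cons 1 (Fin.cons 1 (Fin.cons 1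
          (Fin.cons 0 (fun _ : Fin m => (0 : ℤ)))))))))
      (Fin.cons
        (Fin.cons 1 (Fin.cons 1 (Fin.cons 0 (Fin.cons 0 (Fin.cons 0 (Fin.cons 1
          (Fin.cons 1 (fun _ : Fin m => (0 : ℤ)))))))))
      (Fin.cons
        (Fin.cons 1 (Fin.cons 1 (Fin.cons 1 (Fin.cons 1 (Fin.cons 0 (Fin.cons 0
          (Fin.cons 0 (fun _ : Fin m => (0 : ℤ)))))))))
        (fun i : Fin n =>
          Fin.cons 0 (Fin.cons (a i) (Fin.cons (b i) (Fin.cons (c i)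
            (Fin.cons (d i) (Fin.cons (e i) (Fin.cons (f i) (P i)))))))))))).rank := by
  refine Matrix.rank_eq_of_mulVec_eq (negFirstThree n) (negSumFirstSeven m) fun x => ?_
  have hC : negSumFirstSeven m x =
      Fin.cons (-(x 0 + x (Fin.succ 0) + x (Fin.succ 0).succ + x (Fin.succ 0).succ.succ +
        x (Fin.succ 0).succ.succ.succ + x (Fin.succ 0).succ.succ.succ.succ +
        x (Fin.succ 0).succ.succ.succ.succ.succ)) fun j : Fin (m + 6) => x j.succ := rfl
  have hD (y : Fin (n + 3) → ℤ) : negFirstThree n y =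
      Fin.cons (-y 0) (Fin.cons (-y (Fin.succ 0)) (Fin.cons (-y (Fin.succ 0).succ)
        fun i : Fin n => y i.succ.succ.succ)) := rfl
  rw [hC, hD]
  ext i
  refine Fin.cases ?_ (Fin.cases ?_ (Fin.cases ?_ fun i => ?_)) i <;>
    simp only [Matrix.mulVec, dotProduct, Matrix.of_apply, Fin.sum_univ_succ, Fin.cons_zero,
      Fin.cons_succ, zero_mul, one_mul, Finset.sum_const_zero] <;>
    ring
end

section
/- For all natural numbers n, m, all column vectors a, b, c, d, e, f : Fin n → ℤ and every matrix P : Matrix (Fin n) (Fin m) ℤ, the following holds. Let M∇ be the (n+3) × (m+7) integer matrix whose first three rows are (−1,−1,1,0,0,0,1,0,…,0), (1,0,−1,1,−1,0,0,0,…,0), (1,0,0,0,−1,1,−1,0,…,0) and whose remaining n rows are (0, a_i, b_i, c_i, d_i, e_i, f_i, P_i), and let MΔ be the (n+3) × (m+7) integer matrix whose first three rows are (−1,0,0,1,−1,1,0,0,…,0), (1,−1,0,0,0,−1,1,0,…,0), (1,−1,1,−1,0,0,0,0,…,0) and whose remaining n rows are (0, a_i, b_i, c_i, d_i, e_i, f_i,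 P_i). Then rank M∇ = rank MΔ. (This is the block computation in the paper's Lemma that a Reidemeister move III, in which the seven regions appearing around the move are distinct, preserves the rank of the ℤ-submodule of kernel solutions of the alternating region choice matrix of the double counting rule: A_{a2}(D∇) = M∇ and A_{a2}(DΔ) = MΔ; in the proof MΔ is obtained from M∇ by adding the first column multiplied by (−1)^{j+1} to the j-th column for j = 2, …, 7.) -/
/-- Adding multiples of a fixed column to the other columns does not enlarge the column span. -/
theorem span_range_col_le_of_add_col {R ι κ : Type*} [CommRing R] {A B : Matrix ι κ R} (k : κ)
    (s : κ → R) (h : ∀ i j, B i j = A i j + s j * A i k) :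
    Submodule.span R (Set.range B.col) ≤ Submodule.span R (Set.range A.col) := by
  rw [Submodule.span_le]
  rintro _ ⟨j, rfl⟩
  have hj : B.col j = A.col j + s j • A.col k := by
    ext i
    simpa using h i j
  rw [hj]
  exact add_mem (Submodule.subset_span ⟨j, rfl⟩)
    (Submodule.smul_mem _ _ (Submodule.subset_span ⟨k, rfl⟩))

/-- Adding multiples of a fixed column to the other columns preserves the rank. -/
theorem rank_eq_of_add_col {R ι κ : Type*} [CommRing R] [Fintype κ] {A B : Matrix ι κ R} (k : κ)
    (s : κ → R) (hs : s k = 0) (h : ∀ i j, B i j = A i j + s j * A i k) : A.rank = B.rank := by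
  rw [Matrix.rank_eq_finrank_span_cols, Matrix.rank_eq_finrank_span_cols,
    le_antisymm (span_range_col_le_of_add_col k (-s) fun i j => ?_)
      (span_range_col_le_of_add_col k s h)]
  simp [h, hs]

/-- Reidemeister move III rank computation (alternating, double counting rule; the
seven regions around the move are distinct): the matrices `M∇` and `MΔ` whose
first three rows are `(-1,-1,1,0,0,0,1,0,…,0)`, `(1,0,-1,1,-1,0,0,0,…,0)`,
`(1,0,0,0,-1,1,-1,0,…,0)` and `(-1,0,0,1,-1,1,0,0,…,0)`, `(1,-1,0,0,0,-1,1,0,…,0)`,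
`(1,-1,1,-1,0,0,0,0,…,0)` respectively, with common remaining rows
`(0, a_i, b_i, c_i, d_i, e_i, f_i, P_i)`, have the same rank. -/
theorem reidemeister_III_rank_alt_double
    (n m : ℕ) (a b c d e f : Fin n → ℤ) (P : Matrix (Fin n) (Fin m) ℤ) :
    (Matrix.of (Fin.cons
        (Fin.cons (-1) (Fin.cons (-1) (Fin.cons 1 (Fin.cons 0 (Fin.cons 0 (Fin.cons 0
          (Fin.cons 1 (fun _ : Fin m => (0 : ℤ)))))))))
      (Fin.cons
        (Fin.cons 1 (Fin.cons 0 (Fin.cons (-1) (Fin.cons 1 (Fin.cons (-1) (Fin.cons 0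
          (Fin.cons 0 (fun _ : Fin m => (0 : ℤ)))))))))
      (Fin.cons
        (Fin.cons 1 (Fin.cons 0 (Fin.cons 0 (Fin.cons 0 (Fin.cons (-1) (Fin.cons 1
          (Fin.cons (-1) (fun _ : Fin m => (0 : ℤ)))))))))
        (fun i : Fin n =>
          Fin.cons 0 (Fin.cons (a i) (Fin.cons (b i) (Fin.cons (c i)
            (Fin.cons (d i) (Fin.cons (e i) (Fin.cons (f i) (P i)))))))))))).rank
    = (Matrix.of (Fin.cons
        (Fin.cons (-1) (Fin.cons 0 (Fin.cons 0 (Fin.cons 1 (Fin.cons (-1) (Fin.cons 1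
          (Fin.cons 0 (fun _ : Fin m => (0 : ℤ)))))))))
      (Fin.cons
        (Fin.cons 1 (Fin.cons (-1) (Fin.cons 0 (Fin.cons 0 (Fin.cons 0 (Fin.cons (-1)
          (Fin.cons 1 (fun _ : Fin m => (0 : ℤ)))))))))
      (Fin.cons
        (Fin.cons 1 (Fin.cons (-1) (Fin.cons 1 (Fin.cons (-1) (Fin.cons 0 (Fin.cons 0
          (Fin.cons 0 (fun _ : Fin m => (0 : ℤ)))))))))
        (fun i : Fin n =>
          Fin.cons 0 (Fin.cons (a i) (Fin.cons (b i) (Fin.cons (c i)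
            (Fin.cons (d i) (Fin.cons (e i) (Fin.cons (f i) (P i)))))))))))).rank := by
  refine rank_eq_of_add_col 0
    (Fin.cons 0 (Fin.cons (-1) (Fin.cons 1 (Fin.cons (-1) (Fin.cons 1 (Fin.cons (-1)
      (Fin.cons 1 (fun _ : Fin m => (0 : ℤ))))))))) rfl fun i j => ?_
  refine Fin.cases ?_ (Fin.cases ?_ (Fin.cases ?_ fun i => ?_)) i
  all_goals
    iterate 7
      refine Fin.cases ?_ (fun j => ?_) j
      · simp only [Matrix.of_apply, Fin.cons_zero, Fin.cons_succ]
        ring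
    simp only [Matrix.of_apply, Fin.cons_zero, Fin.cons_succ]
    ring
end

section
/- Let A_d be the 4 × 6 integer matrix with rows (1,1,1,1,0,0), (0,1,1,1,1,0), (0,1,1,0,1,1), (1,1,1,0,0,1). For every c ∈ ℤ^4 there exists u ∈ ℤ^6 with A_d.mulVec u + c = 0 if and only if c₀ − c₁ + c₂ − c₃ = 0. (This is the paper's explicit claim for the definite region choice matrix of the canonical diagram of the (2,4)-torus link: the definite integral region choice problem with score vector c has a solution exactly when c₁ − c₂ + c₃ − c₄ = 0; in particular for (c₁, c₂, c₃, c₄) = (1, 0, 0, −1) no solution exists.) -/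
/-- For the definite region choice matrix of the canonical diagram of the
`(2,4)`-torus link, the definite integral region choice problem with score vector
`c` has a solution if and only if `c₀ - c₁ + c₂ - c₃ = 0`. -/
theorem torus_link_def_region_choice_solvable_iff
    (c : Fin 4 → ℤ) :
    (∃ u : Fin 6 → ℤ,
      (!![1, 1, 1, 1, 0, 0;
          0, 1, 1, 1, 1, 0;
          0, 1, 1, 0, 1, 1;
          1, 1, 1, 0, 0, 1] : Matrix (Fin 4) (Fin 6) ℤ).mulVec u + c = 0) ↔
    c 0 - c 1 + c 2 - c 3 = 0 := by
  constructor
  · rintro ⟨u, hu⟩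
    have h0 := congrFun hu 0
    have h1 := congrFun hu 1
    have h2 := congrFun hu 2
    have h3 := congrFun hu 3
    simp [dotProduct, Fin.sum_univ_succ] at h0 h1 h2 h3
    grind
  · intro h
    refine ⟨![0, 0, 0, -c 0, c 0 - c 1, -c 3], ?_⟩
    ext i
    fin_cases i <;> simp <;> linarith
end

section
/- Let A_a be the 4 × 6 integer matrix with rows (−1,1,1,−1,0,0), (0,1,1,−1,−1,0), (0,1,1,0,−1,−1), (−1,1,1,0,0,−1). For every c ∈ ℤ^4 there exists u ∈ ℤ^6 with A_a.mulVec u + c = 0 if and only if c₀ − c₁ + c₂ − c₃ = 0. (This is the paper's explicit claim for the alternating region choice matrix of the canonical diagram of the (2,4)-torus link: the alternating integral region choice problem with score vector c has a solution exactly when c₁ − c₂ + c₃ − c₄ = 0; in particular for (c₁, c₂, c₃, c₄) = (1, 0, 0, −1) no solution exists.) -/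
/-- For the alternating region choice matrix of the canonical diagram of the
`(2,4)`-torus link, the alternating integral region choice problem with score
vector `c` has a solution if and only if `c₀ - c₁ + c₂ - c₃ = 0`. -/
theorem torus_link_alt_region_choice_solvable_iff
    (c : Fin 4 → ℤ) :
    (∃ u : Fin 6 → ℤ,
      (!![-1, 1, 1, -1, 0, 0;
          0, 1, 1, -1, -1, 0;
          0, 1, 1, 0, -1, -1;
          -1, 1, 1, 0, 0, -1] : Matrix (Fin 4) (Fin 6) ℤ).mulVec u + c = 0) ↔
    c 0 - c 1 + c 2 - c 3 = 0 := by
  constructor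
  · rintro ⟨u, hu⟩
    have h0 := congrFun hu 0
    have h1 := congrFun hu 1
    have h2 := congrFun hu 2
    have h3 := congrFun hu 3
    simp [dotProduct, Fin.sum_univ_succ] at h0 h1 h2 h3
    linarith
  · intro h
    refine ⟨![c 0 - c 1, -c 2, 0, c 1 - c 2, 0, 0], ?_⟩
    ext i
    fin_cases i <;> simp <;> linarith
end
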